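/- Unbiasedness under the leave-one-out baseline: for every Z ≥ 2, ∑_{v : Fin Z → A} P(v) • ((1/Z) ∑_{z : Fin Z} (ρ (v z) * (R (v z) − b_z(v))) • D_{v z}) = fderiv ℝ J θ₀, where b_z(v) = (1/(Z−1)) * ∑_{j ≠ z} R (v j); that is, replacing the within-group mean baseline by the leave-one-out baseline makes the likelihood-ratio gradient estimator exactly unbiased for the policy gradient of J at θ₀. -/

import Mathlib

/-- Expectations of products of functions of distinct coordinates factor under a product weight. -/
theorem sum_prod_mul_prod_eq_prod_sum {ι A K : Type*} [Fintype ι] [DecidableEq ι] [Fintype A]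
    [CommSemiring K] (μ : A → K) (hμ : ∑ a, μ a = 1) (s : Finset ι) (f : ι → A → K) :
    ∑ v : ι → A, (∏ i, μ (v i)) * ∏ i ∈ s, f i (v i) = ∏ i ∈ s, ∑ a, μ a * f i a := by
  have h := Finset.prod_univ_sum (fun _ : ι => (Finset.univ : Finset A))
    (fun i a => μ a * if i ∈ s then f i a else 1)
  rw [Fintype.piFinset_univ] at h
  calc _ = ∑ v : ι → A, ∏ i, μ (v i) * (if i ∈ s then f i (v i) else 1) := by
        simp only [Finset.prod_mul_distrib, Finset.prod_ite_mem, Finset.univ_inter]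
    _ = ∏ i, ∑ a, μ a * (if i ∈ s then f i a else 1) := h.symm
    _ = ∏ i, if i ∈ s then ∑ a, μ a * f i a else 1 := by
        refine Finset.prod_congr rfl fun i _ => ?_
        split_ifs <;> simp [hμ]
    _ = _ := by simp [Finset.prod_ite_mem]

/-- The marginal of a product weight on one coordinate. -/
theorem sum_prod_mul_apply {ι A K : Type*} [Fintype ι] [DecidableEq ι] [Fintype A]
    [CommSemiring K] (μ : A → K) (hμ : ∑ a, μ a = 1) (f : A → K) (z : ι) :
    ∑ v : ι → A, (∏ i, μ (v i)) * f (v z) = ∑ a, μ a * f a := by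
  simpa using sum_prod_mul_prod_eq_prod_sum μ hμ {z} fun _ => f

/-- Two distinct coordinates are independent under a product weight. -/
theorem sum_prod_mul_apply_mul_apply {ι A K : Type*} [Fintype ι] [DecidableEq ι] [Fintype A]
    [CommSemiring K] (μ : A → K) (hμ : ∑ a, μ a = 1) (f g : A → K) {z j : ι} (hzj : j ≠ z) :
    ∑ v : ι → A, (∏ i, μ (v i)) * (f (v z) * g (v j)) =
      (∑ a, μ a * f a) * ∑ a, μ a * g a := by
  simpa [Finset.prod_pair hzj.symm, hzj] using
    sum_prod_mul_prod_eq_prod_sum μ hμ {z, j} fun i => if i = z then f else g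

/-- A baseline depending only on the other coordinates does not change the mean of an estimator
whose centering term has mean zero. -/
theorem sum_prod_mul_leave_one_out {ι A K : Type*} [Fintype ι] [DecidableEq ι] [Fintype A]
    [CommRing K] (μ : A → K) (hμ : ∑ a, μ a = 1) (c R : A → K) (hc : ∑ a, μ a * c a = 0)
    (k : K) (z : ι) :
    ∑ v : ι → A, (∏ i, μ (v i)) *
        (c (v z) * (R (v z) - k * ∑ j ∈ Finset.univ.erase z, R (v j))) =
      ∑ a, μ a * (c a * R a) := by
  have hcross : ∑ v : ι → A, ∑ j ∈ Finset.univ.erase z,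
      (∏ i, μ (v i)) * (c (v z) * R (v j)) = 0 := by
    rw [Finset.sum_comm]
    refine Finset.sum_eq_zero fun j hj => ?_
    rw [sum_prod_mul_apply_mul_apply μ hμ c R (Finset.ne_of_mem_erase hj), hc, zero_mul]
  rw [← sum_prod_mul_apply μ hμ (fun a => c a * R a) z, ← sub_eq_zero,
    ← Finset.sum_sub_distrib]
  calc _ = -k * ∑ v : ι → A, ∑ j ∈ Finset.univ.erase z,
        (∏ i, μ (v i)) * (c (v z) * R (v j)) := by
        rw [Finset.mul_sum]
        refine Finset.sum_congr rfl fun v _ => ?_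
        simp only [← Finset.mul_sum]
        ring
    _ = 0 := by rw [hcross, mul_zero]

/-- Unbiasedness under the leave-one-out baseline: replacing the within-group mean baseline
by the leave-one-out baseline `b_z(v) = (1/(Z-1)) ∑_{j ≠ z} R (v j)` makes the
likelihood-ratio gradient estimator exactly unbiased for the policy gradient of `J` at `θ₀`. -/
theorem leave_one_out_unbiased
    {E : Type*} [NormedAddCommGroup E] [NormedSpace ℝ E]
    {A : Type*} [Fintype A] [Nonempty A]
    (π : E → A → ℝ) (θ₀ : E) (R : A → ℝ) (μ : A → ℝ)
    (hpos : ∀ θ a, 0 < π θ a)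
    (hsum : ∀ θ, ∑ a, π θ a = 1)
    (hdiff : ∀ a, DifferentiableAt ℝ (fun θ => π θ a) θ₀)
    (hμpos : ∀ a, 0 < μ a)
    (hμsum : ∑ a, μ a = 1)
    (Z : ℕ) (hZ : 2 ≤ Z) :
    ∑ v : Fin Z → A,
        (∏ i, μ (v i)) •
          ((1 / (Z : ℝ)) •
            ∑ z : Fin Z,
              ((π θ₀ (v z) / μ (v z)) *
                  (R (v z) -
                    (1 / ((Z : ℝ) - 1)) * ∑ j ∈ Finset.univ.erase z, R (v j))) •
                fderiv ℝ (fun θ => Real.log (π θ (v z))) θ₀)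
      = fderiv ℝ (fun θ => ∑ a, π θ a * R a) θ₀ := by
  have hlog (a : A) : fderiv ℝ (fun θ => Real.log (π θ a)) θ₀ =
      (π θ₀ a)⁻¹ • fderiv ℝ (fun θ => π θ a) θ₀ := fderiv.log (hdiff a) (hpos θ₀ a).ne'
  have hJ : fderiv ℝ (fun θ => ∑ a, π θ a * R a) θ₀ =
      ∑ a, R a • fderiv ℝ (fun θ => π θ a) θ₀ := by
    rw [fderiv_fun_sum fun a _ => (hdiff a).mul_const (R a)]
    exact Finset.sum_congr rfl fun a _ => fderiv_mul_const (hdiff a) (R a)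
  have hzero : ∑ a, fderiv ℝ (fun θ => π θ a) θ₀ = 0 := by
    rw [← fderiv_fun_sum fun a _ => hdiff a]
    simp [hsum]
  ext x
  set c : A → ℝ := fun a =>
    π θ₀ a / μ a * fderiv ℝ (fun θ => Real.log (π θ a)) θ₀ x with hc_def
  have hμc (a : A) : μ a * c a = fderiv ℝ (fun θ => π θ a) θ₀ x := by
    have h₁ := (hμpos a).ne'
    have h₂ := (hpos θ₀ a).ne'
    simp only [hc_def, hlog, smul_apply, smul_eq_mul]
    field_simp
  have hc : ∑ a, μ a * c a = 0 := by
    simpa [hμc] using congrArg (fun L : E →L[ℝ] ℝ => L x) hzero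
  have hZ0 : (Z : ℝ) ≠ 0 := by positivity
  calc _ = (1 / (Z : ℝ)) * ∑ z : Fin Z, ∑ v : Fin Z → A, (∏ i, μ (v i)) *
        (c (v z) * (R (v z) -
          (1 / ((Z : ℝ) - 1)) * ∑ j ∈ Finset.univ.erase z, R (v j))) := by
        rw [Finset.sum_comm, Finset.mul_sum]
        simp only [sum_apply, smul_apply, smul_eq_mul,
          Finset.mul_sum (s := (Finset.univ : Finset (Fin Z))), hc_def]
        refine Finset.sum_congr rfl fun v _ => Finset.sum_congr rfl fun z _ => ?_
        ring
    _ = ∑ a, μ a * (c a * R a) := by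
        simp only [sum_prod_mul_leave_one_out μ hμsum c R hc, Finset.sum_const,
          Finset.card_univ, Fintype.card_fin, nsmul_eq_mul]
        field_simp
    _ = _ := by
        simp only [hJ, sum_apply, smul_apply,
          smul_eq_mul, ← mul_assoc, hμc]
        exact Finset.sum_congr rfl fun a _ => mul_comm _ _
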